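/- Let α > 0 and let φ(x) = a₀ (sech(b₀ x))^{4/α} with a₀, b₀, ω₀ as for the explicit solitary wave of the fourth-order NLS. Consider the eigenvalue problem g''''(x) − g''(x) + ω₀ g(x) − φ(x)^α g(x) = κ g(x) for four times continuously differentiable g : ℝ → ℝ with g, g', g'', g''', g'''' square-integrable. Then: (i) there is no κ < 0 for which a nonzero admissible g solves the problem; and (ii) every admissible g solving the problem with κ = 0 is a real scalar multiple of φ. -/

import Mathlib

open Real MeasureTheory

/-- `g` is an admissible (H⁴-type) eigenfunction candidate: four times continuously
differentiable with square-integrable derivatives up to order four. -/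
def AdmissibleH4 (g : ℝ → ℝ) : Prop :=
  ContDiff ℝ 4 g ∧ ∀ k : ℕ, k ≤ 4 → Integrable (fun x => (iteratedDeriv k g x)^2)

/-- The hyperbolic tangent is differentiable with derivative `1 - tanh ^ 2`. -/
lemma hasDerivAt_tanh_mul (b x : ℝ) :
    HasDerivAt (fun y => Real.tanh (b * y)) (b * (1 - Real.tanh (b * x) ^ 2)) x := by
  have hlin : HasDerivAt (fun y : ℝ => b * y) b x := by
    simpa using (hasDerivAt_id x).const_mul b
  have hc : Real.cosh (b * x) ≠ 0 := (Real.cosh_pos _).ne'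
  have h := hlin.sinh.div hlin.cosh hc
  refine (h.congr_deriv ?_).congr_of_eventuallyEq
    (Filter.Eventually.of_forall fun y => Real.tanh_eq_sinh_div_cosh _)
  rw [Real.tanh_eq_sinh_div_cosh]
  field_simp

/-- Multiplying by a continuous function of `tanh` preserves square integrability. -/
lemma MeasureTheory.MemLp.continuous_tanh_mul {f : ℝ → ℝ} (hf : MemLp f 2) (b : ℝ)
    {p : ℝ → ℝ} (hp : Continuous p) : MemLp (fun x => p (Real.tanh (b * x)) * f x) 2 := by
  obtain ⟨C, hC⟩ := (isCompact_Icc (a := (-1 : ℝ)) (b := 1)).exists_bound_of_continuousOn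
    hp.continuousOn
  have hcont : Continuous fun x : ℝ => p (Real.tanh (b * x)) :=
    hp.comp (continuous_iff_continuousAt.2 fun x => (hasDerivAt_tanh_mul b x).continuousAt)
  refine hf.of_le_mul (c := C) (hcont.aestronglyMeasurable.mul hf.1)
    (Filter.Eventually.of_forall fun x => ?_)
  rw [norm_mul]
  have h := abs_lt.1 (Real.abs_tanh_lt_one (b * x))
  exact mul_le_mul_of_nonneg_right (hC _ ⟨h.1.le, h.2.le⟩) (norm_nonneg _)

/-- An antitone function that is integrable on the whole line vanishes. -/
lemma Antitone.eq_zero_of_integrable {B : ℝ → ℝ} (hB : Antitone B) (hi : Integrable B) (x : ℝ) :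
    B x = 0 := by
  by_contra hne
  rcases lt_or_gt_of_ne hne with h | h
  · have hc : IntegrableOn (fun _ : ℝ => B x) (Set.Ici x) := by
      refine Integrable.mono hi.integrableOn aestronglyMeasurable_const ?_
      refine (ae_restrict_iff' measurableSet_Ici).2 (Filter.Eventually.of_forall fun y hy => ?_)
      have := hB hy
      rw [Real.norm_eq_abs, Real.norm_eq_abs, abs_of_neg h, abs_of_neg (this.trans_lt h)]
      linarith
    simp [integrableOn_const_iff, hne] at hc
  · have hc : IntegrableOn (fun _ : ℝ => B x) (Set.Iic x) := by
      refine Integrable.mono hi.integrableOn aestronglyMeasurable_const ?_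
      refine (ae_restrict_iff' measurableSet_Iic).2 (Filter.Eventually.of_forall fun y hy => ?_)
      have := hB hy
      rw [Real.norm_eq_abs, Real.norm_eq_abs, abs_of_pos h, abs_of_pos (h.trans_le this)]
      linarith
    simp [integrableOn_const_iff, hne] at hc

/-- Square-integrable solutions of the eigenvalue problem with `κ ≤ 0`, for the profile
`sech (b x) ^ s`, satisfy `κ g² = 0` and `g' = - s b tanh (b x) g`. The proof writes
`g L g - (φ h'')² - r (φ h')²`, with `g = φ h`, as the derivative of an integrable function. -/
lemma eigenfunction_rigidity {b s κ : ℝ} (hb : b ≠ 0) (hs : 0 < s) (hκ : κ ≤ 0)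
    {g₀ g₁ g₂ g₃ g₄ : ℝ → ℝ}
    (d₀ : ∀ x, HasDerivAt g₀ (g₁ x) x) (d₁ : ∀ x, HasDerivAt g₁ (g₂ x) x)
    (d₂ : ∀ x, HasDerivAt g₂ (g₃ x) x) (d₃ : ∀ x, HasDerivAt g₃ (g₄ x) x)
    (m₀ : MemLp g₀ 2) (m₁ : MemLp g₁ 2) (m₂ : MemLp g₂ 2) (m₃ : MemLp g₃ 2)
    (heq : ∀ x, g₄ x - b ^ 2 * (2 * s ^ 2 + 4 * s + 4) * g₂ x
      + (b ^ 2 * (2 * s ^ 2 + 4 * s + 4) * (s * b) ^ 2 - (s * b) ^ 4) * g₀ x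
      - b ^ 4 * s * (s + 1) * (s + 2) * (s + 3) * (1 - Real.tanh (b * x) ^ 2) ^ 2 * g₀ x
      = κ * g₀ x) (x : ℝ) :
    κ * g₀ x ^ 2 = 0 ∧ g₁ x + s * b * Real.tanh (b * x) * g₀ x = 0 := by
  set c := s * b with hc
  let t : ℝ → ℝ := fun x => Real.tanh (b * x)
  have dt : ∀ x, HasDerivAt t (b * (1 - t x ^ 2)) x := hasDerivAt_tanh_mul b
  let r : ℝ → ℝ := fun y => b ^ 2 * (4 * s + 4 + (2 * s ^ 2 + 4 * s) * (1 - y ^ 2))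
  let u : ℝ → ℝ := fun x => g₁ x + c * t x * g₀ x
  let p : ℝ → ℝ := fun y => c * b * (1 - y ^ 2) + c ^ 2 * y ^ 2
  let w : ℝ → ℝ := fun x => g₂ x + 2 * c * t x * g₁ x + p (t x) * g₀ x
  let w₁ : ℝ → ℝ := fun x => g₃ x + 2 * c * t x * g₂ x
    + (2 * c * b * (1 - t x ^ 2) + p (t x)) * g₁ x
    + (c ^ 2 - c * b) * (2 * t x * (b * (1 - t x ^ 2))) * g₀ x
  let B : ℝ → ℝ := fun x => g₀ x * (w₁ x - c * t x * w x) - u x * w x - r (t x) * u x * g₀ x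
  have hB : ∀ x, HasDerivAt B (κ * g₀ x ^ 2 - (w x ^ 2 + r (t x) * u x ^ 2)) x := by
    intro x
    have dsq : HasDerivAt (fun x => t x ^ 2) (2 * t x * (b * (1 - t x ^ 2))) x := by
      exact ((dt x).pow 2).congr_deriv (by simp)
    have du : HasDerivAt u _ x := (d₁ x).add (((dt x).const_mul c).mul (d₀ x))
    have dp : HasDerivAt (fun x => p (t x)) _ x :=
      ((dsq.const_sub 1).const_mul (c * b)).add (dsq.const_mul (c ^ 2))
    have dr : HasDerivAt (fun x => r (t x)) _ x :=
      (((dsq.const_sub 1).const_mul (2 * s ^ 2 + 4 * s)).const_add (4 * s + 4)).const_mul (b ^ 2)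
    have dw : HasDerivAt w _ x :=
      ((d₂ x).add (((dt x).const_mul (2 * c)).mul (d₁ x))).add (dp.mul (d₀ x))
    have dw₁ : HasDerivAt w₁ _ x :=
      (((d₃ x).add (((dt x).const_mul (2 * c)).mul (d₂ x))).add
        ((((dsq.const_sub 1).const_mul (2 * c * b)).add dp).mul (d₁ x))).add
        (((((dt x).const_mul 2).mul ((dsq.const_sub 1).const_mul b)).const_mul
          (c ^ 2 - c * b)).mul (d₀ x))
    have dB : HasDerivAt B _ x :=
      (((d₀ x).mul (dw₁.sub (((dt x).const_mul c).mul dw))).sub (du.mul dw)).sub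
        ((dr.mul du).mul (d₀ x))
    refine dB.congr_deriv ?_
    have h := heq x
    change g₄ x - b ^ 2 * (2 * s ^ 2 + 4 * s + 4) * g₂ x
      + (b ^ 2 * (2 * s ^ 2 + 4 * s + 4) * c ^ 2 - c ^ 4) * g₀ x
      - b ^ 4 * s * (s + 1) * (s + 2) * (s + 3) * (1 - t x ^ 2) ^ 2 * g₀ x = κ * g₀ x at h
    simp only [u, w, w₁, p, r, Pi.mul_apply, Pi.add_apply, Pi.sub_apply]
    rw [hc] at h ⊢
    linear_combination (g₀ x) * h
  have hr : ∀ x, 0 < r (t x) := by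
    intro x
    have h1 : 0 < 1 - t x ^ 2 := sub_pos.2 (Real.tanh_sq_lt_one (b * x))
    positivity
  have hκg : ∀ x, κ * g₀ x ^ 2 ≤ 0 := fun x => mul_nonpos_of_nonpos_of_nonneg hκ (sq_nonneg _)
  have hP : ∀ x, 0 ≤ r (t x) * u x ^ 2 := fun x => mul_nonneg (hr x).le (sq_nonneg _)
  have hanti : Antitone B := by
    refine antitone_of_deriv_nonpos (fun x => (hB x).differentiableAt) fun x => ?_
    rw [(hB x).deriv]
    linarith [hκg x, hP x, sq_nonneg (w x)]
  have hint : Integrable B := by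
    have mul {f : ℝ → ℝ} (hf : MemLp f 2) {q : ℝ → ℝ} (hq : Continuous q) :
        MemLp (fun x => q (t x) * f x) 2 := hf.continuous_tanh_mul b hq
    have mu : MemLp u 2 := m₁.add (mul m₀ (q := fun y => c * y) (by fun_prop))
    have mw : MemLp w 2 := (m₂.add (mul m₁ (q := fun y => 2 * c * y) (by fun_prop))).add
      (mul m₀ (q := p) (by fun_prop))
    have mw₁ : MemLp w₁ 2 := ((m₃.add (mul m₂ (q := fun y => 2 * c * y) (by fun_prop))).add
      (mul m₁ (q := fun y => 2 * c * b * (1 - y ^ 2) + p y) (by fun_prop))).add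
      (mul m₀ (q := fun y => (c ^ 2 - c * b) * (2 * y * (b * (1 - y ^ 2)))) (by fun_prop))
    exact ((m₀.integrable_mul (mw₁.sub (mul mw (q := fun y => c * y) (by fun_prop)))).sub
      (mu.integrable_mul mw)).sub ((mul mu (q := r) (by fun_prop)).integrable_mul m₀)
  have hzero : B = fun _ => 0 := funext fun x => hanti.eq_zero_of_integrable hint x
  have h0 : κ * g₀ x ^ 2 - (w x ^ 2 + r (t x) * u x ^ 2) = 0 := by
    refine (hB x).unique ?_
    rw [hzero]
    exact hasDerivAt_const x 0
  have h1 : r (t x) * u x ^ 2 = 0 := by linarith [hκg x, hP x, sq_nonneg (w x)]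
  refine ⟨by linarith [hκg x, hP x, sq_nonneg (w x)], ?_⟩
  simpa [(hr x).ne'] using h1

/-- The solutions of `g' = - s b tanh (b x) g` are the multiples of `sech (b x) ^ s`. -/
lemma eq_mul_sech_rpow {b s : ℝ} {g g₁ : ℝ → ℝ} (d : ∀ x, HasDerivAt g (g₁ x) x)
    (h : ∀ x, g₁ x + s * b * Real.tanh (b * x) * g x = 0) (x : ℝ) :
    g x = g 0 * (Real.cosh (b * x))⁻¹ ^ s := by
  have hd : ∀ x, HasDerivAt (fun x => g x * Real.cosh (b * x) ^ s) 0 x := by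
    intro x
    have hlin : HasDerivAt (fun y : ℝ => b * y) b x := by
      simpa using (hasDerivAt_id x).const_mul b
    have hpos := Real.cosh_pos (b * x)
    refine ((d x).mul (hlin.cosh.rpow_const (p := s) (Or.inl hpos.ne'))).congr_deriv ?_
    have hx := h x
    rw [Real.tanh_eq_sinh_div_cosh] at hx
    rw [Real.rpow_sub_one hpos.ne']
    field_simp at hx ⊢
    linear_combination Real.cosh (b * x) ^ s * hx
  have hconst := is_const_of_deriv_eq_zero (fun x => (hd x).differentiableAt)
    (fun x => (hd x).deriv) x 0
  have hpos : 0 < Real.cosh (b * x) ^ s := Real.rpow_pos_of_pos (Real.cosh_pos _) _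
  simp only [mul_zero, Real.cosh_zero, Real.one_rpow, mul_one] at hconst
  rw [Real.inv_rpow (Real.cosh_pos _).le, ← hconst, mul_inv_cancel_right₀ hpos.ne']

/-- Spectral properties of `𝓛₊ = ∂ₓ⁴ - ∂ₓ² + ω₀ - φ^α` at the explicit solitary
wave: no negative eigenvalues, and the kernel is spanned by `φ`. -/
theorem spectrum_Lplus (α : ℝ) (hα : 0 < α)
    (a₀ b₀ ω₀ : ℝ)
    (ha : a₀ = ((3*α^3 + 22*α^2 + 48*α + 32) / (2*(α^2 + 4*α + 8)^2)) ^ (1/α))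
    (hb : b₀ = α / (2 * Real.sqrt (α^2 + 4*α + 8)))
    (hω : ω₀ = 4*(α^2 + 4*α + 4) / (α^4 + 8*α^3 + 32*α^2 + 64*α + 64))
    (φ : ℝ → ℝ)
    (hφ : ∀ x, φ x = a₀ * (Real.cosh (b₀ * x))⁻¹ ^ ((4:ℝ)/α))
    (Solves : (ℝ → ℝ) → ℝ → Prop)
    (hSolves : ∀ g κ, Solves g κ ↔ ∀ x, iteratedDeriv 4 g x - iteratedDeriv 2 g x
      + ω₀ * g x - φ x ^ α * g x = κ * g x) :
    (¬ ∃ κ : ℝ, κ < 0 ∧ ∃ g : ℝ → ℝ, AdmissibleH4 g ∧ g ≠ 0 ∧ Solves g κ) ∧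
    (∀ g : ℝ → ℝ, AdmissibleH4 g → Solves g 0 →
      ∃ c : ℝ, g = fun x => c * φ x) := by
  have hD : 0 < α ^ 2 + 4 * α + 8 := by positivity
  have ha₀ : 0 < a₀ := by rw [ha]; positivity
  have hb₀ : 0 < b₀ := by rw [hb]; positivity
  have hb2 : b₀ ^ 2 = α ^ 2 / (4 * (α ^ 2 + 4 * α + 8)) := by
    rw [hb, div_pow, mul_pow, Real.sq_sqrt hD.le]; norm_num
  have hb4 : b₀ ^ 4 = (α ^ 2 / (4 * (α ^ 2 + 4 * α + 8))) ^ 2 := by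
    rw [← hb2]; ring
  have hK : b₀ ^ 2 * (2 * (4 / α) ^ 2 + 4 * (4 / α) + 4) = 1 := by
    rw [hb2]; field_simp; ring
  have hω' : ω₀ = 1 * (4 / α * b₀) ^ 2 - (4 / α * b₀) ^ 4 := by
    have hDD : α^4 + 8*α^3 + 32*α^2 + 64*α + 64 = (α ^ 2 + 4 * α + 8) ^ 2 := by ring
    rw [hω, mul_pow, mul_pow, hb2, hb4, hDD]; field_simp; ring
  have ha' : a₀ ^ α = b₀ ^ 4 * (4 / α) * (4 / α + 1) * (4 / α + 2) * (4 / α + 3) := by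
    rw [ha, ← Real.rpow_mul (by positivity), one_div_mul_cancel hα.ne', Real.rpow_one, hb4]
    field_simp; ring
  have hφα : ∀ x, φ x ^ α = b₀ ^ 4 * (4 / α) * (4 / α + 1) * (4 / α + 2) * (4 / α + 3)
      * (1 - Real.tanh (b₀ * x) ^ 2) ^ 2 := by
    intro x
    have hpos := Real.cosh_pos (b₀ * x)
    have hsq : 1 - Real.tanh (b₀ * x) ^ 2 = (Real.cosh (b₀ * x))⁻¹ ^ 2 := by
      rw [Real.tanh_eq_sinh_div_cosh]
      field_simp
      linarith [Real.cosh_sq (b₀ * x)]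
    rw [hφ, Real.mul_rpow ha₀.le (by positivity), ← Real.rpow_mul (by positivity),
      div_mul_cancel₀ _ hα.ne', ha', hsq, ← pow_mul]
    norm_cast
  have key : ∀ κ ≤ 0, ∀ g, AdmissibleH4 g → Solves g κ → ∀ x,
      κ * g x ^ 2 = 0 ∧ iteratedDeriv 1 g x + 4 / α * b₀ * Real.tanh (b₀ * x) * g x = 0 := by
    intro κ hκ g hg hsol x
    have d : ∀ k : ℕ, k < 4 → ∀ x, HasDerivAt (iteratedDeriv k g) (iteratedDeriv (k + 1) g x) x := by
      intro k hk x
      rw [iteratedDeriv_succ]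
      exact (hg.1.differentiable_iteratedDeriv k (by exact_mod_cast hk) x).hasDerivAt
    have m : ∀ k : ℕ, k ≤ 4 → MemLp (iteratedDeriv k g) 2 := fun k hk =>
      (memLp_two_iff_integrable_sq (hg.1.continuous_iteratedDeriv k
        (by exact_mod_cast hk)).aestronglyMeasurable).2 (hg.2 k hk)
    have e := (hSolves g κ).1 hsol
    have d₀ := d 0 (by norm_num)
    have m₀ := m 0 (by norm_num)
    rw [iteratedDeriv_zero] at d₀ m₀
    refine eigenfunction_rigidity hb₀.ne' (by positivity : 0 < 4 / α) hκ d₀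
      (d 1 (by norm_num)) (d 2 (by norm_num)) (d 3 (by norm_num)) m₀
      (m 1 (by norm_num)) (m 2 (by norm_num)) (m 3 (by norm_num)) (fun x => ?_) x
    rw [hK, ← hω', ← hφα x, one_mul]
    exact e x
  refine ⟨?_, fun g hg hsol => ?_⟩
  · rintro ⟨κ, hκ, g, hg, hne, hsol⟩
    refine hne (funext fun x => ?_)
    simpa [hκ.ne] using (key κ hκ.le g hg hsol x).1
  · have hd : ∀ x, HasDerivAt g (iteratedDeriv 1 g x) x := fun x => by
      rw [iteratedDeriv_one]
      exact (hg.1.differentiable (by norm_num) x).hasDerivAt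
    refine ⟨g 0 / a₀, funext fun x => ?_⟩
    rw [hφ, ← mul_assoc, div_mul_cancel₀ _ ha₀.ne']
    exact eq_mul_sech_rpow hd (fun x => (key 0 le_rfl g hg hsol x).2) x
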